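/- Let n ≥ 2 and let u : closure(𝔹ⁿ) → ℝⁿ be a C¹ map whose restriction to S^{n−1} is a homeomorphism onto its image. Then det(Du) cannot vanish identically on 𝔹ⁿ; equivalently, there exists x ∈ 𝔹ⁿ with rank Du(x) = n. -/

import Mathlib

open Metric

namespace BdryHomeo

lemma det_poly (n : ℕ) (A : EuclideanSpace ℝ (Fin n) →L[ℝ] EuclideanSpace ℝ (Fin n)) :
    ∃ p : Polynomial ℝ, p.natDegree ≤ n ∧ ∀ t : ℝ,
      p.eval t = (ContinuousLinearMap.id ℝ _ + t • A).det := by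
  classical
  let b := (EuclideanSpace.basisFun (Fin n) ℝ).toBasis
  let M : Matrix (Fin n) (Fin n) ℝ := LinearMap.toMatrix b b
    (A : EuclideanSpace ℝ (Fin n) →ₗ[ℝ] EuclideanSpace ℝ (Fin n))
  refine ⟨Matrix.det ((Polynomial.X : Polynomial ℝ) • M.map Polynomial.C
    + (1 : Matrix (Fin n) (Fin n) ℝ).map Polynomial.C), ?_, ?_⟩
  · simpa using Polynomial.natDegree_det_X_add_C_le M 1
  · intro t
    rw [ContinuousLinearMap.det, ← LinearMap.det_toMatrix b, ← Polynomial.coe_evalRingHom,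
      RingHom.map_det]
    congr 1
    have : LinearMap.toMatrix b b ((ContinuousLinearMap.id ℝ _ + t • A :
        EuclideanSpace ℝ (Fin n) →L[ℝ] EuclideanSpace ℝ (Fin n)) :
        EuclideanSpace ℝ (Fin n) →ₗ[ℝ] EuclideanSpace ℝ (Fin n)) = 1 + t • M := by
      rw [ContinuousLinearMap.toLinearMap_add, ContinuousLinearMap.toLinearMap_smul, map_add,
        map_smul]
      congr 1
      exact LinearMap.toMatrix_id b
    rw [this]
    ext i j
    by_cases hij : i = j
    · simp [Matrix.one_apply, hij]; ring
    · simp [Matrix.one_apply, hij]; ring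

lemma surj {n : ℕ} (g : EuclideanSpace ℝ (Fin n) → EuclideanSpace ℝ (Fin n)) (L : NNReal)
    (hg : LipschitzOnWith L g (closedBall 0 1)) (h0 : ∀ x ∈ sphere 0 1, g x = 0)
    (t : NNReal) (ht : t * L < 1) (y : EuclideanSpace ℝ (Fin n)) (hy : y ∈ closedBall 0 1) :
    ∃ x ∈ closedBall 0 1, x + (t : ℝ) • g x = y := by
  classical
  set G : EuclideanSpace ℝ (Fin n) → EuclideanSpace ℝ (Fin n) :=
    fun x => if ‖x‖ ≤ 1 then g x else 0 with hG
  have key : ∀ x z : EuclideanSpace ℝ (Fin n), ‖x‖ ≤ 1 → 1 < ‖z‖ → ‖g x‖ ≤ L * ‖x - z‖ := by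
    intro x z hx hz
    have hz0 : (0:ℝ) < ‖z‖ := by linarith
    set w := ‖z‖⁻¹ • z with hw
    have hwn : ‖w‖ = 1 := by
      rw [hw, norm_smul, norm_inv, norm_norm, inv_mul_cancel₀ hz0.ne']
    have hzw : z = ‖z‖ • w := by
      rw [hw, smul_smul, mul_inv_cancel₀ hz0.ne', one_smul]
    have h1 := hg.dist_le_mul x (by simpa using hx) w (by simp [hwn])
    rw [h0 w (by simp [hwn]), dist_zero_right, dist_eq_norm] at h1
    refine h1.trans ?_
    gcongr
    have hin : inner ℝ x w ≤ 1 := by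
      have := real_inner_le_norm x w
      rw [hwn] at this; linarith
    have e1 : ‖x - z‖ ^ 2 = ‖x‖ ^ 2 - 2 * (‖z‖ * inner ℝ x w) + ‖z‖ ^ 2 := by
      rw [norm_sub_sq_real]
      congr 3
      conv_lhs => rw [hzw]
      rw [inner_smul_right]
    have e2 : ‖x - w‖ ^ 2 = ‖x‖ ^ 2 - 2 * (inner ℝ x w) + 1 := by
      rw [norm_sub_sq_real, hwn]; norm_num
    refine le_of_sq_le_sq ?_ (norm_nonneg _)
    rw [e1, e2]
    nlinarith [mul_nonneg (sub_nonneg.2 hz.le) (sub_nonneg.2 hin)]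
  have hGL : LipschitzWith L G := by
    refine LipschitzWith.of_dist_le_mul fun x z => ?_
    rw [dist_eq_norm, dist_eq_norm]
    by_cases hx : ‖x‖ ≤ 1 <;> by_cases hz : ‖z‖ ≤ 1
    · simp only [hG, hx, hz, if_true]
      have := hg.dist_le_mul x (by simpa using hx) z (by simpa using hz)
      rwa [dist_eq_norm, dist_eq_norm] at this
    · simp only [hG, hx, hz, if_true, if_false, sub_zero]
      exact key x z hx (not_le.1 hz)
    · simp only [hG, hx, hz, if_true, if_false, zero_sub, norm_neg]
      rw [norm_sub_rev]
      exact key z x hz (not_le.1 hx)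
    · simp only [hG, hx, hz, if_false, sub_zero, norm_zero]
      positivity
  have hc : ContractingWith (t * L) (fun x => y - (t : ℝ) • G x) := by
    refine ⟨ht, LipschitzWith.of_dist_le_mul fun x z => ?_⟩
    have := hGL.dist_le_mul x z
    rw [dist_eq_norm] at this ⊢
    have e : y - (t:ℝ) • G x - (y - (t:ℝ) • G z) = -((t:ℝ) • (G x - G z)) := by
      rw [smul_sub]; abel
    rw [e, norm_neg, norm_smul, NNReal.coe_mul, mul_assoc]
    simp only [NNReal.norm_eq]
    gcongr
  have hfix := hc.fixedPoint_isFixedPt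
  set x := hc.fixedPoint
  have hx : y - (t:ℝ) • G x = x := hfix
  by_cases h : ‖x‖ ≤ 1
  · refine ⟨x, by simpa using h, ?_⟩
    simp only [hG, h, if_true] at hx
    exact (sub_eq_iff_eq_add.1 hx).symm
  · simp only [hG, h, if_false, smul_zero, sub_zero] at hx
    rw [← hx] at h
    exact absurd (by simpa using hy) h

lemma no_retract {n : ℕ} (r : EuclideanSpace ℝ (Fin n) → EuclideanSpace ℝ (Fin n))
    (hr : ContDiffOn ℝ 1 r (closedBall 0 1)) (hn : ∀ x ∈ closedBall 0 1, ‖r x‖ = 1)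
    (hid : ∀ x ∈ sphere 0 1, r x = x) : False := by
  classical
  set B : Set (EuclideanSpace ℝ (Fin n)) := closedBall 0 1 with hB
  have hBc : IsCompact B := isCompact_closedBall _ _
  have hBconv : Convex ℝ B := convex_closedBall _ _
  have hud : UniqueDiffOn ℝ B := uniqueDiffOn_convex hBconv (by
    rw [hB, interior_closedBall _ one_ne_zero]; exact ⟨0, by simp⟩)
  set g := fun x => r x - x with hg
  have hgC : ContDiffOn ℝ 1 g B := hr.sub contDiffOn_id
  set A := fun x => fderivWithin ℝ g B x with hA
  have hAc : ContinuousOn A B := hgC.continuousOn_fderivWithin hud le_rfl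
  have hAd : ∀ x ∈ B, HasFDerivWithinAt g (A x) B x := fun x hx =>
    (hgC.differentiableOn one_ne_zero x hx).hasFDerivWithinAt
  obtain ⟨C, hC⟩ := hBc.exists_bound_of_continuousOn hAc
  set L : NNReal := C.toNNReal with hL
  have hAL : ∀ x ∈ B, ‖A x‖₊ ≤ L := fun x hx => by
    rw [← NNReal.coe_le_coe]; exact (hC x hx).trans (Real.le_coe_toNNReal C)
  have hLip : LipschitzOnWith L g B :=
    hBconv.lipschitzOnWith_of_nnnorm_fderivWithin_le (hgC.differentiableOn one_ne_zero) hAL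
  -- positivity of det near the identity
  have hdet : ∀ᶠ M in nhds (ContinuousLinearMap.id ℝ (EuclideanSpace ℝ (Fin n))), 0 < M.det := by
    refine (ContinuousLinearMap.continuous_det.tendsto _).eventually (lt_mem_nhds ?_)
    simp [ContinuousLinearMap.det]
  obtain ⟨ε, hε, hdet⟩ := Metric.eventually_nhds_iff.1 hdet
  set δ : ℝ := min 1 ε / (L + 1) / 2 with hδ
  have hLp : (0:ℝ) < L + 1 := by positivity
  have hδ0 : 0 < δ := by positivity
  have hδL : δ * (L + 1) = min 1 ε / 2 := by rw [hδ]; field_simp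
  have hvol : ∀ t : ℝ, 0 < t → t ≤ δ → 
      ∫ x in B, (ContinuousLinearMap.id ℝ _ + t • A x).det = ∫ x in B, (1:ℝ) := by
    intro t ht0 ht
    have htL : t * (L + 1) ≤ min 1 ε / 2 := by
      rw [← hδL]; gcongr
    have htL' : t * L < min 1 ε := by
      have : 0 < min 1 ε := by positivity
      nlinarith
    have ht1 : t ≤ 1 := by
      have := min_le_left 1 ε
      nlinarith [L.coe_nonneg]
    set f := fun x => x + t • g x with hf
    have hfd : ∀ x ∈ B, HasFDerivWithinAt f (ContinuousLinearMap.id ℝ _ + t • A x) B x :=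
      fun x hx => (hasFDerivWithinAt_id x B).add ((hAd x hx).const_smul t)
    have himg : f '' B = B := by
      apply Set.Subset.antisymm
      · rintro _ ⟨x, hx, rfl⟩
        have : f x = (1 - t) • x + t • r x := by
          simp only [hf, hg, smul_sub, sub_smul, one_smul]; abel
        rw [this]
        refine hBconv hx ?_ (by linarith) ht0.le (by ring)
        simp [hB, hn x hx]
      · intro y hy
        obtain ⟨x, hx, h⟩ := surj g L hLip (fun x hx => by simp [hg, hid x hx]) ⟨t, ht0.le⟩
          (by rw [← NNReal.coe_lt_coe]; exact htL'.trans_le (min_le_left _ _)) y hy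
        exact ⟨x, hx, h⟩
    have hinj : Set.InjOn f B := by
      intro x hx z hz hxz
      have h1 := hLip.dist_le_mul x hx z hz
      rw [dist_eq_norm, dist_eq_norm] at h1
      have h2 : x - z = - (t • (g x - g z)) := by
        have : x + t • g x = z + t • g z := hxz
        rw [smul_sub, neg_sub, sub_eq_sub_iff_add_eq_add, this, add_comm]
      have h3 : ‖x - z‖ ≤ t * (L * ‖x - z‖) := by
        conv_lhs => rw [h2, norm_neg, norm_smul, Real.norm_of_nonneg ht0.le]
        gcongr
      have h4 : t * L < 1 := htL'.trans_le (min_le_left _ _)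
      have : ‖x - z‖ = 0 := by nlinarith [norm_nonneg (x - z)]
      exact sub_eq_zero.1 (norm_eq_zero.1 this)
    have hm := MeasureTheory.integral_image_eq_integral_abs_det_fderiv_smul MeasureTheory.volume
      (isClosed_closedBall.measurableSet) hfd hinj (fun _ => (1:ℝ))
    rw [himg] at hm
    rw [hm]
    refine MeasureTheory.setIntegral_congr_fun isClosed_closedBall.measurableSet fun x hx => ?_
    have : 0 < (ContinuousLinearMap.id ℝ _ + t • A x).det := by
      apply hdet
      rw [dist_eq_norm, add_sub_cancel_left, norm_smul, Real.norm_of_nonneg ht0.le]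
      have : ‖A x‖ ≤ L := hAL x hx
      calc t * ‖A x‖ ≤ t * L := by gcongr
        _ < min 1 ε := htL'
        _ ≤ ε := min_le_right _ _
    simp [abs_of_pos this]
  have hzero : ∀ x ∈ B, (ContinuousLinearMap.id ℝ _ + (1:ℝ) • A x).det = 0 := by
    intro x hx
    have hrd : HasFDerivWithinAt r (ContinuousLinearMap.id ℝ _ + (1:ℝ) • A x) B x := by
      have := (hasFDerivWithinAt_id x B).add ((hAd x hx).const_smul (1:ℝ))
      refine HasFDerivWithinAt.congr this (fun y hy => ?_) ?_ <;> simp [hg]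
    set D := ContinuousLinearMap.id ℝ _ + (1:ℝ) • A x
    by_contra hne
    have hi := hrd.inner ℝ hrd
    have hc : HasFDerivWithinAt (fun y => inner ℝ (r y) (r y)) 
        (0 : EuclideanSpace ℝ (Fin n) →L[ℝ] ℝ) B x := by
      refine HasFDerivWithinAt.congr' (hasFDerivWithinAt_const (1:ℝ) x B) (fun y hy => ?_) hx
      rw [real_inner_self_eq_norm_sq, hn y hy]; norm_num
    have he := (hud x hx).eq hi hc
    have hs : Function.Surjective D := by
      have := (LinearMap.equivOfDetNeZero (D : _ →ₗ[ℝ] EuclideanSpace ℝ (Fin n)) hne).surjective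
      exact this
    obtain ⟨v, hv⟩ := hs (r x)
    have := congrArg (fun T => T v) he
    simp [hv, hn x hx] at this
  -- Lagrange
  set v : ℕ → ℝ := fun i => δ / (i + 1) with hv
  set s := Finset.range (n + 1) with hs
  have hvinj : Set.InjOn v s := by
    intro i _ j _ hij
    have hi : (0:ℝ) < i + 1 := by positivity
    have hj : (0:ℝ) < j + 1 := by positivity
    simp only [hv] at hij
    rw [div_eq_div_iff hi.ne' hj.ne'] at hij
    have := mul_left_cancel₀ hδ0.ne' hij
    have : (j:ℝ) = i := by linarith
    exact_mod_cast this.symm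
  set c : ℕ → ℝ := fun i => (Lagrange.basis s v i).eval 1 with hc
  have hcs : ∑ i ∈ s, c i = 1 := by
    have := congrArg (Polynomial.eval 1) (Lagrange.sum_basis hvinj ⟨0, by simp [hs]⟩)
    rw [Polynomial.eval_finsetSum] at this
    simpa using this
  have hint : ∀ x ∈ B, (0:ℝ) = ∑ i ∈ s, c i * (ContinuousLinearMap.id ℝ _ + v i • A x).det := by
    intro x hx
    obtain ⟨p, hp, hpe⟩ := det_poly n (A x)
    have hdeg : p.degree < s.card := by
      refine lt_of_le_of_lt Polynomial.degree_le_natDegree ?_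
      rw [hs, Finset.card_range]
      exact_mod_cast Nat.lt_succ_of_le hp
    have h1 := congrArg (Polynomial.eval 1) (Lagrange.eq_interpolate hvinj hdeg)
    rw [hpe, hzero x hx, Lagrange.interpolate_apply, Polynomial.eval_finsetSum] at h1
    rw [h1]
    refine Finset.sum_congr rfl fun i _ => ?_
    rw [Polynomial.eval_mul, Polynomial.eval_C, hpe, mul_comm]
  have hI : ∫ x in B, (0:ℝ) = ∫ x in B, (1:ℝ) := by
    calc ∫ x in B, (0:ℝ) 
        = ∫ x in B, ∑ i ∈ s, c i * (ContinuousLinearMap.id ℝ _ + v i • A x).det :=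
          MeasureTheory.setIntegral_congr_fun isClosed_closedBall.measurableSet fun x hx => hint x hx
      _ = ∑ i ∈ s, ∫ x in B, c i * (ContinuousLinearMap.id ℝ _ + v i • A x).det := by
          refine MeasureTheory.integral_finsetSum _ fun i _ => ?_
          refine ContinuousOn.integrableOn_compact hBc ?_
          refine continuousOn_const.mul ?_
          exact ContinuousLinearMap.continuous_det.comp_continuousOn
            (continuousOn_const.add (hAc.const_smul (v i)))
      _ = ∑ i ∈ s, c i * ∫ x in B, (1:ℝ) := by
          refine Finset.sum_congr rfl fun i _ => ?_
          rw [MeasureTheory.integral_const_mul, hvol (v i) (by positivity)]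
          simp only [hv]
          refine div_le_self hδ0.le ?_
          have : (0:ℝ) ≤ i := by positivity
          linarith
      _ = ∫ x in B, (1:ℝ) := by rw [← Finset.sum_mul, hcs, one_mul]
  have hpos : 0 < MeasureTheory.volume B := by
    rw [hB]; exact Metric.measure_closedBall_pos _ _ one_pos
  have hfin : MeasureTheory.volume B ≠ ⊤ := hBc.measure_lt_top.ne
  simp only [MeasureTheory.integral_zero, MeasureTheory.setIntegral_const, smul_eq_mul, mul_one] at hI
  exact (ENNReal.toReal_pos hpos.ne' hfin).ne hI

lemma no_nonzero {n : ℕ} (w : EuclideanSpace ℝ (Fin n) → EuclideanSpace ℝ (Fin n))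
    (hw : ContDiffOn ℝ 1 w (closedBall 0 1)) (hne : ∀ x ∈ closedBall 0 1, w x ≠ 0)
    (hid : ∀ x ∈ sphere 0 1, ‖w x - x‖ < 1) : False := by
  set G := fun x => -(‖w x‖⁻¹ • w x) with hG
  have hGC : ContDiffOn ℝ 1 G (closedBall 0 1) :=
    ((((hw.norm ℝ hne).inv fun x hx => norm_ne_zero_iff.2 (hne x hx))).smul hw).neg
  have hGn : ∀ x ∈ closedBall 0 1, ‖G x‖ = 1 := fun x hx => by
    simp only [hG]
    rw [norm_neg, norm_smul, norm_inv, norm_norm,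
      inv_mul_cancel₀ (norm_ne_zero_iff.2 (hne x hx))]
  have hGx : ∀ x ∈ closedBall 0 1, x - G x ≠ 0 := by
    intro x hx h
    have hxG : x = G x := sub_eq_zero.1 h
    have hx1 : ‖x‖ = 1 := by rw [hxG]; exact hGn x hx
    have h1 := hid x (by simpa using hx1)
    have hw0 := norm_pos_iff.2 (hne x hx)
    have h2 : w x = - (‖w x‖ • x) := by
      have : -(‖w x‖ • x) = -(‖w x‖ • G x) := by rw [← hxG]
      rw [this]
      simp only [hG]
      rw [smul_neg, neg_neg, smul_smul, mul_inv_cancel₀ hw0.ne', one_smul]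
    have h3 : w x - x = -((‖w x‖ + 1) • x) := by
      conv_lhs => rw [h2]
      rw [add_smul, one_smul]; abel
    rw [h3, norm_neg, norm_smul, hx1, Real.norm_of_nonneg (by positivity)] at h1
    linarith
  set r := fun x => G x + (-2 * inner ℝ (G x) (x - G x) * (‖x - G x‖ ^ 2)⁻¹) • (x - G x) with hr
  have hsub : ContDiffOn ℝ 1 (fun x => x - G x) (closedBall 0 1) := contDiffOn_id.sub hGC
  refine no_retract r ?_ ?_ ?_
  · refine hGC.add (ContDiffOn.fun_smul ?_ hsub)
    refine (contDiffOn_const.mul (hGC.inner ℝ hsub)).mul ?_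
    refine ContDiffOn.inv (hsub.norm_sq ℝ) fun x hx => ?_
    exact pow_ne_zero 2 (norm_ne_zero_iff.2 (hGx x hx))
  · intro x hx
    have hp : ‖x - G x‖ ^ 2 ≠ 0 := pow_ne_zero 2 (norm_ne_zero_iff.2 (hGx x hx))
    have : ‖r x‖ ^ 2 = 1 := by
      simp only [hr]
      rw [norm_add_sq_real, hGn x hx, inner_smul_right, norm_smul, mul_pow, Real.norm_eq_abs,
        sq_abs]
      field_simp
      ring
    nlinarith [norm_nonneg (r x)]
  · intro x hx
    have hx' : x ∈ closedBall (0:EuclideanSpace ℝ (Fin n)) 1 := sphere_subset_closedBall hx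
    have hp : ‖x - G x‖ ^ 2 ≠ 0 := pow_ne_zero 2 (norm_ne_zero_iff.2 (hGx x hx'))
    have hx1 : ‖x‖ = 1 := by simpa using hx
    have : -2 * inner ℝ (G x) (x - G x) * (‖x - G x‖ ^ 2)⁻¹ = 1 := by
      rw [← div_eq_mul_inv, div_eq_one_iff_eq hp, norm_sub_sq_real, inner_sub_right,
        real_inner_self_eq_norm_sq, hGn x hx', hx1, real_inner_comm]
      ring
    simp only [hr]
    rw [this]; simp

lemma exists_smooth {n : ℕ} (u : EuclideanSpace ℝ (Fin n) → EuclideanSpace ℝ (Fin n))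
    (hu : ContinuousOn u (sphere 0 1))
    (hinj : Set.InjOn u (sphere (0 : EuclideanSpace ℝ (Fin n)) 1)) :
    ∃ P : EuclideanSpace ℝ (Fin n) → EuclideanSpace ℝ (Fin n), ContDiff ℝ 1 P ∧
      ∀ x ∈ sphere 0 1, ‖P (u x) - x‖ < 1/2 := by
  set t : EuclideanSpace ℝ (Fin n) → Set (EuclideanSpace ℝ (Fin n)) :=
    fun y => ⋂ x ∈ {x | x ∈ sphere (0 : EuclideanSpace ℝ (Fin n)) 1 ∧ u x = y}, ball x (1/2) with ht
  obtain ⟨P, hP⟩ := exists_contMDiffMap_forall_mem_convex_of_local_const (n := 1)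
    (modelWithCornersSelf ℝ (EuclideanSpace ℝ (Fin n))) (t := t)
    (fun y => convex_iInter₂ fun x _ => convex_ball _ _) (by
      intro y
      -- constant
      have hex : ∃ c, ∀ x ∈ sphere (0 : EuclideanSpace ℝ (Fin n)) 1, u x = y → x = c := by
        by_cases h : ∃ c ∈ sphere (0 : EuclideanSpace ℝ (Fin n)) 1, u c = y
        · obtain ⟨c, hc, rfl⟩ := h
          exact ⟨c, fun x hx h => hinj hx hc h⟩
        · exact ⟨0, fun x hx hxy => (h ⟨x, hx, hxy⟩).elim⟩
      obtain ⟨c, hc⟩ := hex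
      refine ⟨c, ?_⟩
      set T := sphere (0 : EuclideanSpace ℝ (Fin n)) 1 \ ball c (1/2) with hT
      have hTc : IsCompact T := (isCompact_sphere _ _).diff isOpen_ball
      have hTi : IsClosed (u '' T) := (hTc.image_of_continuousOn (hu.mono Set.sdiff_subset)).isClosed
      have hy : y ∉ u '' T := by
        rintro ⟨x, hx, hxy⟩
        exact hx.2 (by rw [hc x hx.1 hxy]; exact mem_ball_self (by norm_num))
      filter_upwards [hTi.isOpen_compl.mem_nhds hy] with z hz
      simp only [ht, Set.mem_iInter]
      rintro x ⟨hx, hxz⟩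
      rw [mem_ball_comm]
      by_contra hcon
      exact hz ⟨x, ⟨hx, hcon⟩, hxz⟩)
  refine ⟨P, P.contMDiff.contDiff, fun x hx => ?_⟩
  have := hP (u x)
  simp only [ht, Set.mem_iInter] at this
  have := this x ⟨hx, rfl⟩
  rwa [mem_ball, dist_eq_norm] at this

end BdryHomeo

/-- If `n ≥ 2` and `u` is `C¹` on the closed unit ball with `u` restricted to the boundary
sphere a homeomorphism onto its image (equivalently, continuous and injective there), then
`det Du` cannot vanish identically on the open ball: there is an interior point where the
differential has full rank `n`. -/
theorem exists_full_rank_of_boundary_homeomorphism (n : ℕ) (hn : 2 ≤ n)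
    (u : EuclideanSpace ℝ (Fin n) → EuclideanSpace ℝ (Fin n))
    (hu : ContDiffOn ℝ 1 u (closedBall 0 1))
    (hinj : Set.InjOn u (sphere (0 : EuclideanSpace ℝ (Fin n)) 1)) :
    ∃ x ∈ ball (0 : EuclideanSpace ℝ (Fin n)) 1,
      LinearMap.rank (fderiv ℝ u x : EuclideanSpace ℝ (Fin n) →ₗ[ℝ] EuclideanSpace ℝ (Fin n))
        = n := by
  by_contra hcon
  push Not at hcon
  have hdet : ∀ x ∈ ball (0 : EuclideanSpace ℝ (Fin n)) 1, (fderiv ℝ u x).det = 0 := by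
    intro x hx
    by_contra hne
    refine hcon x hx ?_
    have hs := (LinearMap.equivOfDetNeZero
      (fderiv ℝ u x : EuclideanSpace ℝ (Fin n) →ₗ[ℝ] EuclideanSpace ℝ (Fin n)) hne).surjective
    have hs' : Function.Surjective
      (fderiv ℝ u x : EuclideanSpace ℝ (Fin n) →ₗ[ℝ] EuclideanSpace ℝ (Fin n)) := hs
    rw [LinearMap.rank, LinearMap.range_eq_top.2 hs', rank_top, ← Module.finrank_eq_rank,
      finrank_euclideanSpace_fin]
  have hdiff := hu.differentiableOn one_ne_zero
  have hb : MeasureTheory.volume (u '' ball 0 1) = 0 := by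
    refine MeasureTheory.addHaar_image_eq_zero_of_det_fderivWithin_eq_zero _
      (f' := fun x => fderiv ℝ u x) (fun x hx => ?_) hdet
    exact ((hdiff x (ball_subset_closedBall hx)).differentiableAt
      (closedBall_mem_nhds_of_mem hx)).hasFDerivAt.hasFDerivWithinAt
  have hS : MeasureTheory.volume (u '' sphere 0 1) = 0 :=
    MeasureTheory.addHaar_image_eq_zero_of_differentiableOn_of_addHaar_eq_zero _
      (hdiff.mono sphere_subset_closedBall) (MeasureTheory.Measure.addHaar_sphere_of_ne_zero _ _ one_ne_zero)
  have hB : MeasureTheory.volume (u '' closedBall 0 1) = 0 := by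
    rw [← ball_union_sphere, Set.image_union]
    exact MeasureTheory.measure_union_null hb hS
  obtain ⟨P, hP, hPu⟩ := BdryHomeo.exists_smooth u
    (hu.continuousOn.mono sphere_subset_closedBall) hinj
  have hPB : MeasureTheory.volume (P '' (u '' closedBall 0 1)) = 0 :=
    MeasureTheory.addHaar_image_eq_zero_of_differentiableOn_of_addHaar_eq_zero _
      (hP.differentiable one_ne_zero).differentiableOn hB
  obtain ⟨c, hc, hcP⟩ : ∃ c ∈ ball (0 : EuclideanSpace ℝ (Fin n)) (1/2),
      c ∉ P '' (u '' closedBall 0 1) := by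
    by_contra h
    push Not at h
    have := MeasureTheory.measure_mono_null h hPB
    exact (Metric.measure_ball_pos MeasureTheory.volume (0 : EuclideanSpace ℝ (Fin n))
      (by norm_num : (0:ℝ) < 1/2)).ne' this
  refine BdryHomeo.no_nonzero (fun x => P (u x) - c) ((hP.comp_contDiffOn hu).sub contDiffOn_const)
    (fun x hx h => hcP ⟨u x, ⟨x, hx, rfl⟩, sub_eq_zero.1 h⟩) fun x hx => ?_
  have h1 := hPu x hx
  have h2 : ‖c‖ < 1/2 := by simpa using hc
  calc ‖P (u x) - c - x‖ = ‖(P (u x) - x) - c‖ := by congr 1; abel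
    _ ≤ ‖P (u x) - x‖ + ‖c‖ := norm_sub_le _ _
    _ < 1 := by linarith
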